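/- In the limited-rank game, the true payoff bounds given a perceived matrix A at capability c are: P⁻(A,c,x,y) = xᵀAy − σ_c(A)·‖N(Aᵀ)ᵀx‖₂·‖N(A)ᵀy‖₂ and P⁺(A,c,x,y) = xᵀAy + σ_c(A)·‖N(Aᵀ)ᵀx‖₂·‖N(A)ᵀy‖₂, where the concretization set is the set of matrices whose best rank-c truncated-SVD approximation equals A. -/

import Mathlib

open Matrix

/-- `HasSingVals m n M s` means `M = U Σ Vᵀ` is a singular value decomposition
of `M` with singular values `s` (sorted nonincreasingly). -/
def HasSingVals (m n : ℕ) (M : Matrix (Fin m) (Fin n) ℝ)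
    (s : Fin (min m n) → ℝ) : Prop :=
  ∃ (Um : Matrix (Fin m) (Fin m) ℝ) (Vm : Matrix (Fin n) (Fin n) ℝ),
    Um.transpose * Um = 1 ∧ Vm.transpose * Vm = 1 ∧
    Antitone s ∧ (∀ i, 0 ≤ s i) ∧
    ∀ a b, M a b = ∑ i : Fin (min m n),
      s i * Um a (Fin.castLE (Nat.min_le_left m n) i) *
        Vm b (Fin.castLE (Nat.min_le_right m n) i)

/-- The set of all best rank-`r` approximations of `M` obtained by truncating a
singular value decomposition of `M` after the `r` largest singular values. -/
def truncSet (m n r : ℕ) (M : Matrix (Fin m) (Fin n) ℝ) :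
    Set (Matrix (Fin m) (Fin n) ℝ) :=
  {A | ∃ (Um : Matrix (Fin m) (Fin m) ℝ) (Vm : Matrix (Fin n) (Fin n) ℝ)
      (s : Fin (min m n) → ℝ),
    Um.transpose * Um = 1 ∧ Vm.transpose * Vm = 1 ∧
    Antitone s ∧ (∀ i, 0 ≤ s i) ∧
    (∀ a b, M a b = ∑ i : Fin (min m n),
      s i * Um a (Fin.castLE (Nat.min_le_left m n) i) *
        Vm b (Fin.castLE (Nat.min_le_right m n) i)) ∧
    (∀ a b, A a b = ∑ i : Fin (min m n), if (i : ℕ) < r then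
      s i * Um a (Fin.castLE (Nat.min_le_left m n) i) *
        Vm b (Fin.castLE (Nat.min_le_right m n) i) else 0)}

/-- The sum `∑ i, t i • (U i) (V i)ᵀ` over paired columns of `U` and `V`. -/
def columnPairing {m n : ℕ} (U : Matrix (Fin m) (Fin m) ℝ) (V : Matrix (Fin n) (Fin n) ℝ)
    (t : Fin (min m n) → ℝ) : Matrix (Fin m) (Fin n) ℝ :=
  Matrix.of fun a b => ∑ i : Fin (min m n),
    t i * U a (Fin.castLE (Nat.min_le_left m n) i) * V b (Fin.castLE (Nat.min_le_right m n) i)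

section ColumnPairing

variable {m n : ℕ} {U U' : Matrix (Fin m) (Fin m) ℝ} {V V' : Matrix (Fin n) (Fin n) ℝ}
  {s t : Fin (min m n) → ℝ}

theorem dotProduct_columnPairing_mulVec (U : Matrix (Fin m) (Fin m) ℝ)
    (V : Matrix (Fin n) (Fin n) ℝ) (t : Fin (min m n) → ℝ) (x : Fin m → ℝ) (y : Fin n → ℝ) :
    x ⬝ᵥ columnPairing U V t *ᵥ y = ∑ i : Fin (min m n),
      t i * (Uᵀ *ᵥ x) (Fin.castLE (Nat.min_le_left m n) i) *
        (Vᵀ *ᵥ y) (Fin.castLE (Nat.min_le_right m n) i) := by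
  simp only [dotProduct, mulVec, columnPairing, Matrix.of_apply, Matrix.transpose_apply,
    Finset.mul_sum, Finset.sum_mul]
  rw [Finset.sum_comm]
  conv_rhs => rw [Finset.sum_comm]
  refine Finset.sum_congr rfl fun b _ => ?_
  rw [Finset.sum_comm]
  refine Finset.sum_congr rfl fun i _ => Finset.sum_congr rfl fun a _ => ?_
  ring

theorem transpose_mulVec_mulVec {p q : ℕ} {W : Matrix (Fin p) (Fin q) ℝ} (hW : Wᵀ * W = 1)
    (z : Fin q → ℝ) : Wᵀ *ᵥ (W *ᵥ z) = z := by
  rw [Matrix.mulVec_mulVec, hW, Matrix.one_mulVec]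

theorem dotProduct_mulVec_self_of_transpose_mul_self {p q : ℕ} {W : Matrix (Fin p) (Fin q) ℝ}
    (hW : Wᵀ * W = 1) (z : Fin q → ℝ) : (W *ᵥ z) ⬝ᵥ (W *ᵥ z) = z ⬝ᵥ z := by
  rw [Matrix.dotProduct_mulVec, Matrix.vecMul_mulVec, ← Matrix.dotProduct_mulVec,
    hW, Matrix.one_mulVec]

theorem columnPairing_mulVec_eq_zero_iff (hU : Uᵀ * U = 1) (y : Fin n → ℝ) :
    columnPairing U V t *ᵥ y = 0 ↔
      ∀ i, t i * (Vᵀ *ᵥ y) (Fin.castLE (Nat.min_le_right m n) i) = 0 := by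
  refine ⟨fun h i => ?_, fun h => ?_⟩
  · have := dotProduct_columnPairing_mulVec U V t
      (U *ᵥ Pi.single (Fin.castLE (Nat.min_le_left m n) i) 1) y
    rw [h, dotProduct_zero, transpose_mulVec_mulVec hU, Finset.sum_eq_single i] at this
    · simpa using this.symm
    · intro j _ hj
      simp [hj]
    · simp
  · rw [← dotProduct_self_eq_zero, dotProduct_columnPairing_mulVec]
    refine Finset.sum_eq_zero fun i _ => ?_
    rw [mul_right_comm, h i, zero_mul]

theorem columnPairing_transpose_mulVec_eq_zero_iff (hV : Vᵀ * V = 1) (x : Fin m → ℝ) :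
    (columnPairing U V t)ᵀ *ᵥ x = 0 ↔
      ∀ i, t i * (Uᵀ *ᵥ x) (Fin.castLE (Nat.min_le_left m n) i) = 0 := by
  have key (y : Fin n → ℝ) : y ⬝ᵥ (columnPairing U V t)ᵀ *ᵥ x =
      ∑ i : Fin (min m n), t i * (Uᵀ *ᵥ x) (Fin.castLE (Nat.min_le_left m n) i) *
        (Vᵀ *ᵥ y) (Fin.castLE (Nat.min_le_right m n) i) := by
    rw [Matrix.mulVec_transpose, dotProduct_comm, ← Matrix.dotProduct_mulVec]
    exact dotProduct_columnPairing_mulVec U V t x y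
  refine ⟨fun h i => ?_, fun h => ?_⟩
  · have := key (V *ᵥ Pi.single (Fin.castLE (Nat.min_le_right m n) i) 1)
    rw [h, dotProduct_zero, transpose_mulVec_mulVec hV, Finset.sum_eq_single i] at this
    · simpa using this.symm
    · intro j _ hj
      simp [hj]
    · simp
  · rw [← dotProduct_self_eq_zero, key]
    refine Finset.sum_eq_zero fun i _ => ?_
    rw [h i, zero_mul]

theorem sum_castLE_le {p q : ℕ} (h : p ≤ q) {f : Fin q → ℝ} (hf : ∀ i, 0 ≤ f i) :
    ∑ i, f (Fin.castLE h i) ≤ ∑ i, f i := by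
  have := Finset.sum_map Finset.univ (Fin.castLEEmb h) f
  simp only [Fin.coe_castLEEmb] at this
  rw [← this]
  exact Finset.sum_le_univ_sum_of_nonneg hf

theorem abs_sum_mul_castLE_le {σ : ℝ} (hσ : 0 ≤ σ) (f : Fin m → ℝ) (g : Fin n → ℝ)
    (ht : ∀ i, |t i| ≤ σ) :
    |∑ i : Fin (min m n), t i * f (Fin.castLE (Nat.min_le_left m n) i) *
        g (Fin.castLE (Nat.min_le_right m n) i)| ≤ σ * √(f ⬝ᵥ f) * √(g ⬝ᵥ g) := by
  have hcs := Real.sum_mul_le_sqrt_mul_sqrt Finset.univ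
    (fun i : Fin (min m n) => |f (Fin.castLE (Nat.min_le_left m n) i)|)
    (fun i => |g (Fin.castLE (Nat.min_le_right m n) i)|)
  simp only [sq_abs] at hcs
  calc _ ≤ ∑ i : Fin (min m n), |t i * f (Fin.castLE (Nat.min_le_left m n) i) *
        g (Fin.castLE (Nat.min_le_right m n) i)| := Finset.abs_sum_le_sum_abs _ _
    _ ≤ ∑ i : Fin (min m n), σ * (|f (Fin.castLE (Nat.min_le_left m n) i)| *
        |g (Fin.castLE (Nat.min_le_right m n) i)|) := by
        refine Finset.sum_le_sum fun i _ => ?_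
        rw [abs_mul, abs_mul, mul_assoc]
        exact mul_le_mul_of_nonneg_right (ht i) (by positivity)
    _ ≤ σ * (√(f ⬝ᵥ f) * √(g ⬝ᵥ g)) := by
        rw [← Finset.mul_sum]
        refine mul_le_mul_of_nonneg_left (hcs.trans ?_) hσ
        simp only [dotProduct, ← sq]
        gcongr
        · exact sum_castLE_le _ (f := fun i => f i ^ 2) fun i => sq_nonneg _
        · exact sum_castLE_le _ (f := fun i => g i ^ 2) fun i => sq_nonneg _
    _ = _ := by ring

theorem exists_support_le_mulVec_eq_zero {n j : ℕ} (hj : j < n) (P : Matrix (Fin n) (Fin n) ℝ) :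
    ∃ a : ℕ → ℝ, (∃ i ≤ j, a i ≠ 0) ∧ (∀ i, j < i → a i = 0) ∧
      ∀ k : Fin n, (k : ℕ) < j → (P *ᵥ fun l => a l) k = 0 := by
  let T : Matrix (Fin n) (Fin n) ℝ := Matrix.of fun k l =>
    if (k : ℕ) < j then P k l else if (l : ℕ) = k + 1 then 1 else 0
  have hT : T.det = 0 := by
    refine Matrix.det_eq_zero_of_row_eq_zero (⟨n - 1, by omega⟩ : Fin n) fun l => ?_
    have := l.isLt
    simp only [T, Matrix.of_apply]
    rw [if_neg (by omega), if_neg (by omega)]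
  obtain ⟨b, hb0, hb⟩ := Matrix.exists_mulVec_eq_zero_iff.mpr hT
  have hzero (i : Fin n) (hi : j < i) : b i = 0 := by
    have h := congrFun hb ⟨i - 1, by omega⟩
    simp only [mulVec, dotProduct, T, Matrix.of_apply, Pi.zero_apply] at h
    rw [Finset.sum_eq_single i] at h
    · rw [if_neg (by omega), if_pos (by omega), one_mul] at h
      exact h
    · intro l _ hl
      have : (l : ℕ) ≠ i := fun h => hl (Fin.ext h)
      rw [if_neg (by omega), if_neg (by omega), zero_mul]
    · simp
  obtain ⟨i, hi⟩ := Function.ne_iff.mp hb0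
  refine ⟨fun k => if h : k < n then b ⟨k, h⟩ else 0, ⟨i, ?_, by simpa using hi⟩, ?_, ?_⟩
  · by_contra! h
    exact hi (hzero i h)
  · intro k hk
    by_cases h : k < n
    · simpa [h] using hzero ⟨k, h⟩ hk
    · simp [h]
  · intro k hk
    simpa [mulVec, dotProduct, T, hk] using congrFun hb k

/-- A singular value is bounded by any other candidate for the singular value of the same index. -/
theorem le_of_columnPairing_eq (hU : Uᵀ * U = 1) (hV : Vᵀ * V = 1) (hU' : U'ᵀ * U' = 1)
    (hV' : V'ᵀ * V' = 1) (h : columnPairing U' V' t = columnPairing U V s)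
    (j : Fin (min m n)) (ht : ∀ i ≤ j, t j ≤ t i) (hs : ∀ i, j ≤ i → s i ≤ s j)
    (hs0 : ∀ i, 0 ≤ s i) : t j ≤ s j := by
  obtain ⟨a, ⟨k, hk, hak⟩, ha, hP⟩ := exists_support_le_mulVec_eq_zero
    (j.isLt.trans_le (Nat.min_le_right m n)) (Vᵀ * V')
  have hsum (p : ℕ) (hp : (j : ℕ) < p) :
      ∑ i : Fin p, a i * a i = ∑ i ∈ Finset.range (j + 1), a i * a i := by
    rw [Fin.sum_univ_eq_sum_range (fun i => a i * a i)]
    refine (Finset.sum_subset (by simpa using hp) fun i _ hi => ?_).symm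
    rw [ha i (by simpa using hi), zero_mul]
  have hpos : 0 < ∑ i ∈ Finset.range (j + 1), a i * a i :=
    Finset.sum_pos' (fun i _ => mul_self_nonneg _)
      ⟨k, by simp; omega, mul_self_pos.mpr hak⟩
  set S := ∑ i ∈ Finset.range (j + 1), a i * a i
  have h1 := dotProduct_columnPairing_mulVec U' V' t (U' *ᵥ fun l => a l) (V' *ᵥ fun l => a l)
  have h2 := dotProduct_columnPairing_mulVec U V s (U' *ᵥ fun l => a l) (V' *ᵥ fun l => a l)
  rw [transpose_mulVec_mulVec hU', transpose_mulVec_mulVec hV', h, h2] at h1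
  have hlow : t j * S ≤ ∑ i : Fin (min m n), t i * a i * a i := by
    rw [← hsum _ j.isLt, Finset.mul_sum]
    refine Finset.sum_le_sum fun i _ => ?_
    rw [mul_assoc]
    rcases le_or_gt i j with hij | hij
    · exact mul_le_mul_of_nonneg_right (ht i hij) (mul_self_nonneg _)
    · simp [ha i hij]
  have hup := abs_sum_mul_castLE_le (t := fun i => if i < j then 0 else s i) (hs0 j)
    (Uᵀ *ᵥ (U' *ᵥ fun l => a l)) (Vᵀ *ᵥ (V' *ᵥ fun l => a l)) (fun i => by
      split_ifs with hij
      · simpa using hs0 j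
      · rw [abs_of_nonneg (hs0 i)]
        exact hs i (not_lt.mp hij))
  have hUt : Uᵀᵀ * Uᵀ = 1 := by rw [Matrix.transpose_transpose, mul_eq_one_comm.mp hU]
  have hVt : Vᵀᵀ * Vᵀ = 1 := by rw [Matrix.transpose_transpose, mul_eq_one_comm.mp hV]
  rw [dotProduct_mulVec_self_of_transpose_mul_self hUt,
    dotProduct_mulVec_self_of_transpose_mul_self hVt,
    dotProduct_mulVec_self_of_transpose_mul_self hU',
    dotProduct_mulVec_self_of_transpose_mul_self hV'] at hup
  simp only [dotProduct] at hup
  rw [hsum m (j.isLt.trans_le (Nat.min_le_left m n)),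
    hsum n (j.isLt.trans_le (Nat.min_le_right m n)), mul_assoc,
    Real.mul_self_sqrt hpos.le] at hup
  have heq : ∑ i : Fin (min m n), (if i < j then 0 else s i) *
        (Uᵀ *ᵥ (U' *ᵥ fun l => a l)) (Fin.castLE (Nat.min_le_left m n) i) *
        (Vᵀ *ᵥ (V' *ᵥ fun l => a l)) (Fin.castLE (Nat.min_le_right m n) i) =
      ∑ i : Fin (min m n), t i * a i * a i := by
    refine Eq.trans (Finset.sum_congr rfl fun i _ => ?_) h1
    split_ifs with hij
    · rw [Matrix.mulVec_mulVec (fun l : Fin n => a l),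
        hP (Fin.castLE (Nat.min_le_right m n) i) hij, mul_zero, mul_zero]
    · rfl
  rw [heq] at hup
  exact le_of_mul_le_mul_right (hlow.trans ((le_abs_self _).trans hup)) hpos

theorem eq_zero_of_rank_le {c : ℕ} (hU : Uᵀ * U = 1) (hV : Vᵀ * V = 1) (hs : Antitone s)
    (hs0 : ∀ i, 0 ≤ s i) (hrank : (columnPairing U V s).rank ≤ c) (i : Fin (min m n))
    (hi : c ≤ i) : s i = 0 := by
  by_contra hne
  have hpos : 0 < s i := (hs0 i).lt_of_ne' hne
  let e (l : Fin (i + 1)) : Fin (min m n) := Fin.castLE i.isLt l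
  have hD : (Uᵀ * columnPairing U V s * V).submatrix
      (fun l => Fin.castLE (Nat.min_le_left m n) (e l))
      (fun l => Fin.castLE (Nat.min_le_right m n) (e l)) = diagonal fun l => s (e l) := by
    ext p q
    have := dotProduct_columnPairing_mulVec U V s
      (U *ᵥ Pi.single (Fin.castLE (Nat.min_le_left m n) (e p)) 1)
      (V *ᵥ Pi.single (Fin.castLE (Nat.min_le_right m n) (e q)) 1)
    rw [transpose_mulVec_mulVec hU, transpose_mulVec_mulVec hV, Finset.sum_eq_single (e p),
      dotProduct_comm, Matrix.dotProduct_mulVec, ← Matrix.mulVec_transpose, dotProduct_comm,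
      single_one_dotProduct, Matrix.mulVec_mulVec, Matrix.mulVec_mulVec, Matrix.mulVec_single_one,
      Matrix.col_apply] at this
    · rw [Matrix.submatrix_apply, this, Matrix.diagonal_apply, Pi.single_eq_same,
        mul_one, Pi.single_apply, mul_ite, mul_one, mul_zero]
      simp only [Fin.ext_iff, Fin.val_castLE, e]
    · intro j _ hj
      simp [hj]
    · simp
  have h1 : (diagonal fun l => s (e l)).rank = i + 1 := by
    rw [Matrix.rank_of_isUnit, Fintype.card_fin]
    rw [Matrix.isUnit_diagonal, Pi.isUnit_iff]
    intro l
    exact (hpos.trans_le (hs (Nat.le_of_lt_succ l.isLt))).ne'.isUnit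
  have h2 : (diagonal fun l => s (e l)).rank ≤ (columnPairing U V s).rank := by
    rw [← hD]
    refine (Matrix.rank_submatrix_le _ _ _).trans ?_
    exact (Matrix.rank_mul_le_left _ _).trans (Matrix.rank_mul_le_right _ _)
  omega

theorem exists_orthogonal_extension {p c : ℕ} {W : Matrix (Fin p) (Fin p) ℝ}
    (hW : Wᵀ * W = 1) {w : Fin p → ℝ} (hw : w ⬝ᵥ w = 1)
    (h : ∀ k : Fin p, (k : ℕ) < c → (Wᵀ *ᵥ w) k = 0) :
    ∃ W' : Matrix (Fin p) (Fin p) ℝ, W'ᵀ * W' = 1 ∧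
      ∀ (k : Fin p) (a : Fin p), ((k : ℕ) < c → W' a k = W a k) ∧ ((k : ℕ) = c → W' a k = w a) := by
  let v (k : Fin p) : EuclideanSpace ℝ (Fin p) :=
    WithLp.toLp 2 (if (k : ℕ) = c then w else W.col k)
  have hWk (k l : Fin p) : W.col k ⬝ᵥ W.col l = if k = l then 1 else 0 := by
    rw [← Matrix.one_apply, ← hW]; rfl
  have hWw (k : Fin p) (hk : (k : ℕ) < c) : W.col k ⬝ᵥ w = 0 := h k hk
  have hv : Orthonormal ℝ (({k | (k : ℕ) ≤ c} : Set (Fin p)).domRestrict v) := by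
    rw [orthonormal_iff_ite]
    rintro ⟨k, hk⟩ ⟨l, hl⟩
    simp only [Set.mem_ofPred_eq] at hk hl
    rw [Set.domRestrict_apply, Set.domRestrict_apply, EuclideanSpace.inner_toLp_toLp, star_trivial]
    simp only [Subtype.mk.injEq]
    by_cases hkc : (k : ℕ) = c <;> by_cases hlc : (l : ℕ) = c
    · rw [if_pos hkc, if_pos hlc, hw, if_pos (Fin.ext (hkc.trans hlc.symm))]
    · rw [if_pos hkc, if_neg hlc, hWw l (by omega), if_neg (by rintro rfl; exact hlc hkc)]
    · rw [if_neg hkc, if_pos hlc, dotProduct_comm, hWw k (by omega),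
        if_neg (by rintro rfl; exact hkc hlc)]
    · rw [if_neg hkc, if_neg hlc, dotProduct_comm, hWk]
  obtain ⟨b, hb⟩ := hv.exists_orthonormalBasis_extension_of_card_eq (by simp)
  refine ⟨Matrix.of fun a k => b k a, ?_, fun k a => ⟨fun hk => ?_, fun hk => ?_⟩⟩
  · ext k l
    rw [Matrix.one_apply, ← orthonormal_iff_ite.mp b.orthonormal k l]
    simp [Matrix.mul_apply, PiLp.inner_apply, mul_comm]
  · have := hb k (Set.mem_ofPred.mpr hk.le)
    simp [this, v, hk.ne]
  · have := hb k (Set.mem_ofPred.mpr hk.le)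
    simp [this, v, hk]

end ColumnPairing

section LimitedRank

variable {m n : ℕ}

theorem dotProduct_projection {p q l : ℕ} {M : Matrix (Fin l) (Fin p) ℝ}
    {W : Matrix (Fin p) (Fin q) ℝ} (hW : Wᵀ * W = 1)
    (hker : ∀ u, M *ᵥ u = 0 ↔ ∃ z, W *ᵥ z = u) (x : Fin p → ℝ) {u : Fin p → ℝ}
    (hu : M *ᵥ u = 0) : (W *ᵥ (Wᵀ *ᵥ x)) ⬝ᵥ u = x ⬝ᵥ u := by
  obtain ⟨z, rfl⟩ := (hker u).mp hu
  rw [Matrix.dotProduct_mulVec, ← Matrix.mulVec_transpose, transpose_mulVec_mulVec hW,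
    Matrix.dotProduct_mulVec x, ← Matrix.mulVec_transpose]

theorem exists_columnPairing_of_mem_truncSet {r : ℕ} {A B : Matrix (Fin m) (Fin n) ℝ}
    (h : A ∈ truncSet m n r B) :
    ∃ (U : Matrix (Fin m) (Fin m) ℝ) (V : Matrix (Fin n) (Fin n) ℝ) (t : Fin (min m n) → ℝ),
      Uᵀ * U = 1 ∧ Vᵀ * V = 1 ∧ Antitone t ∧ (∀ i, 0 ≤ t i) ∧ B = columnPairing U V t ∧
        A = columnPairing U V fun i => if (i : ℕ) < r then t i else 0 := by
  obtain ⟨U, V, t, hU, hV, ht, ht0, hB, hA⟩ := h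
  refine ⟨U, V, t, hU, hV, ht, ht0, Matrix.ext hB, Matrix.ext fun a b => ?_⟩
  simp [hA, columnPairing, ite_mul]

theorem columnPairing_mem_truncSet {r : ℕ} {U : Matrix (Fin m) (Fin m) ℝ}
    {V : Matrix (Fin n) (Fin n) ℝ} {t : Fin (min m n) → ℝ} (hU : Uᵀ * U = 1) (hV : Vᵀ * V = 1)
    (ht : Antitone t) (ht0 : ∀ i, 0 ≤ t i) :
    columnPairing U V (fun i => if (i : ℕ) < r then t i else 0) ∈
      truncSet m n r (columnPairing U V t) :=
  ⟨U, V, t, hU, hV, ht, ht0, fun _ _ => rfl, fun a b => by simp [columnPairing, ite_mul]⟩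

/-- The payoff of a matrix whose truncation is `A` differs from that of `A` by at most the last
retained singular value times the norms of the components of `x` and `y` in the kernels. -/
theorem abs_payoff_sub_le {r k k' : ℕ} {A B : Matrix (Fin m) (Fin n) ℝ} {σ : ℝ} (hσ : 0 ≤ σ)
    (hB : A ∈ truncSet m n r B)
    (hle : ∀ (U : Matrix (Fin m) (Fin m) ℝ) (V : Matrix (Fin n) (Fin n) ℝ)
      (t : Fin (min m n) → ℝ), Uᵀ * U = 1 → Vᵀ * V = 1 → Antitone t → (∀ i, 0 ≤ t i) →
      A = columnPairing U V (fun i => if (i : ℕ) < r then t i else 0) →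
      ∀ i : Fin (min m n), r ≤ i → t i ≤ σ)
    {NA : Matrix (Fin n) (Fin k) ℝ} {NAt : Matrix (Fin m) (Fin k') ℝ}
    (hNA1 : NAᵀ * NA = 1) (hNA2 : ∀ y, A *ᵥ y = 0 ↔ ∃ z, NA *ᵥ z = y)
    (hNAt1 : NAtᵀ * NAt = 1) (hNAt2 : ∀ x, Aᵀ *ᵥ x = 0 ↔ ∃ z, NAt *ᵥ z = x)
    (x : Fin m → ℝ) (y : Fin n → ℝ) :
    |x ⬝ᵥ B *ᵥ y - x ⬝ᵥ A *ᵥ y| ≤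
      σ * √((NAtᵀ *ᵥ x) ⬝ᵥ (NAtᵀ *ᵥ x)) * √((NAᵀ *ᵥ y) ⬝ᵥ (NAᵀ *ᵥ y)) := by
  obtain ⟨U, V, t, hU, hV, ht, ht0, hBe, hAe⟩ := exists_columnPairing_of_mem_truncSet hB
  have hts := hle U V t hU hV ht ht0 hAe
  have hUx (i : Fin (min m n)) (hi : ¬ (i : ℕ) < r) :
      (Uᵀ *ᵥ x) (Fin.castLE (Nat.min_le_left m n) i) =
        (Uᵀ *ᵥ (NAt *ᵥ (NAtᵀ *ᵥ x))) (Fin.castLE (Nat.min_le_left m n) i) := by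
    have h := dotProduct_projection hNAt1 hNAt2 x
      (u := U *ᵥ Pi.single (Fin.castLE (Nat.min_le_left m n) i) 1) (by
        rw [hAe, columnPairing_transpose_mulVec_eq_zero_iff hV, transpose_mulVec_mulVec hU]
        intro j
        by_cases hj : (j : ℕ) < r
        · have : j ≠ i := by rintro rfl; exact hi hj
          simp [this]
        · simp [hj])
    rw [Matrix.dotProduct_mulVec, Matrix.dotProduct_mulVec x, dotProduct_single_one,
      dotProduct_single_one] at h
    rw [Matrix.mulVec_transpose, Matrix.mulVec_transpose U, h]
  have hVy (i : Fin (min m n)) (hi : ¬ (i : ℕ) < r) :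
      (Vᵀ *ᵥ y) (Fin.castLE (Nat.min_le_right m n) i) =
        (Vᵀ *ᵥ (NA *ᵥ (NAᵀ *ᵥ y))) (Fin.castLE (Nat.min_le_right m n) i) := by
    have h := dotProduct_projection hNA1 hNA2 y
      (u := V *ᵥ Pi.single (Fin.castLE (Nat.min_le_right m n) i) 1) (by
        rw [hAe, columnPairing_mulVec_eq_zero_iff hU, transpose_mulVec_mulVec hV]
        intro j
        by_cases hj : (j : ℕ) < r
        · have : j ≠ i := by rintro rfl; exact hi hj
          simp [this]
        · simp [hj])
    rw [Matrix.dotProduct_mulVec, Matrix.dotProduct_mulVec y, dotProduct_single_one,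
      dotProduct_single_one] at h
    rw [Matrix.mulVec_transpose, Matrix.mulVec_transpose V, h]
  have hUt : Uᵀᵀ * Uᵀ = 1 := by rw [Matrix.transpose_transpose, mul_eq_one_comm.mp hU]
  have hVt : Vᵀᵀ * Vᵀ = 1 := by rw [Matrix.transpose_transpose, mul_eq_one_comm.mp hV]
  have hbound := abs_sum_mul_castLE_le (t := fun i => if (i : ℕ) < r then 0 else t i) hσ
    (Uᵀ *ᵥ (NAt *ᵥ (NAtᵀ *ᵥ x))) (Vᵀ *ᵥ (NA *ᵥ (NAᵀ *ᵥ y))) (fun i => by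
      split_ifs with hi
      · simpa using hσ
      · rw [abs_of_nonneg (ht0 i)]
        exact hts i (not_lt.mp hi))
  rw [dotProduct_mulVec_self_of_transpose_mul_self hUt,
    dotProduct_mulVec_self_of_transpose_mul_self hVt,
    dotProduct_mulVec_self_of_transpose_mul_self hNAt1,
    dotProduct_mulVec_self_of_transpose_mul_self hNA1] at hbound
  convert hbound using 2
  rw [hBe]
  nth_rw 1 [hAe]
  rw [dotProduct_columnPairing_mulVec, dotProduct_columnPairing_mulVec,
    ← Finset.sum_sub_distrib]
  refine Finset.sum_congr rfl fun i _ => ?_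
  by_cases hi : (i : ℕ) < r
  · simp [hi]
  · simp [hi, hUx i hi, hVy i hi]

/-- Replacing the pair of singular vectors with index `c` by unit vectors `u` and `w` in the kernels
of `Aᵀ` and `A` produces a matrix whose truncation is `A`. -/
theorem exists_mem_truncSet_payoff_eq {c : ℕ} (hc : 1 ≤ c) {U : Matrix (Fin m) (Fin m) ℝ}
    {V : Matrix (Fin n) (Fin n) ℝ} {s : Fin (min m n) → ℝ} (hU : Uᵀ * U = 1) (hV : Vᵀ * V = 1)
    (hs : Antitone s) (hs0 : ∀ i, 0 ≤ s i) (hrank : ∀ i : Fin (min m n), c ≤ i → s i = 0)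
    (hcm : c - 1 < min m n) (hpos : 0 < s ⟨c - 1, hcm⟩) {u : Fin m → ℝ} {w : Fin n → ℝ}
    (hu1 : u ⬝ᵥ u = 1) (hw1 : w ⬝ᵥ w = 1) (hu : (columnPairing U V s)ᵀ *ᵥ u = 0)
    (hw : columnPairing U V s *ᵥ w = 0) (x : Fin m → ℝ) (y : Fin n → ℝ) :
    ∃ B, columnPairing U V s ∈ truncSet m n (min c (min m n)) B ∧
      x ⬝ᵥ B *ᵥ y = x ⬝ᵥ columnPairing U V s *ᵥ y +
        s ⟨c - 1, hcm⟩ * (x ⬝ᵥ u) * (y ⬝ᵥ w) := by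
  rw [columnPairing_transpose_mulVec_eq_zero_iff hV] at hu
  rw [columnPairing_mulVec_eq_zero_iff hU] at hw
  have hspos (i : Fin (min m n)) (hi : (i : ℕ) < c) : s i ≠ 0 :=
    (hpos.trans_le (hs (Fin.mk_le_mk.mpr (by omega) : i ≤ ⟨c - 1, hcm⟩))).ne'
  have hu0 (k : Fin m) (hk : (k : ℕ) < c) : (Uᵀ *ᵥ u) k = 0 :=
    (mul_eq_zero.mp (hu ⟨k, by omega⟩)).resolve_left (hspos ⟨k, by omega⟩ hk)
  have hw0 (k : Fin n) (hk : (k : ℕ) < c) : (Vᵀ *ᵥ w) k = 0 :=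
    (mul_eq_zero.mp (hw ⟨k, by omega⟩)).resolve_left (hspos ⟨k, by omega⟩ hk)
  have hUt : Uᵀᵀ * Uᵀ = 1 := by rw [Matrix.transpose_transpose, mul_eq_one_comm.mp hU]
  have hVt : Vᵀᵀ * Vᵀ = 1 := by rw [Matrix.transpose_transpose, mul_eq_one_comm.mp hV]
  have hltm : c < m := by
    by_contra! h
    have : Uᵀ *ᵥ u = 0 := funext fun k => hu0 k (by omega)
    rw [← dotProduct_mulVec_self_of_transpose_mul_self hUt, this] at hu1
    simp at hu1
  have hltn : c < n := by
    by_contra! h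
    have : Vᵀ *ᵥ w = 0 := funext fun k => hw0 k (by omega)
    rw [← dotProduct_mulVec_self_of_transpose_mul_self hVt, this] at hw1
    simp at hw1
  obtain ⟨U', hU', hUU'⟩ := exists_orthogonal_extension hU hu1 hu0
  obtain ⟨V', hV', hVV'⟩ := exists_orthogonal_extension hV hw1 hw0
  let t (i : Fin (min m n)) : ℝ :=
    if (i : ℕ) < c then s i else if (i : ℕ) = c then s ⟨c - 1, hcm⟩ else 0
  have ht0 (i) : 0 ≤ t i := by
    simp only [t]
    split_ifs
    exacts [hs0 i, hs0 _, le_rfl]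
  have ht : Antitone t := by
    intro i j hij
    have hij' : (i : ℕ) ≤ j := hij
    by_cases hj : (j : ℕ) < c
    · simp only [t, if_pos hj, if_pos (hij'.trans_lt hj)]
      exact hs hij
    · by_cases hj' : (j : ℕ) = c
      · simp only [t, if_neg hj, if_pos hj']
        split_ifs with h1 h2
        · exact hs (Fin.mk_le_mk.mpr (by omega) : i ≤ ⟨c - 1, hcm⟩)
        · exact le_rfl
        · omega
      · have : t j = 0 := by simp only [t, if_neg hj, if_neg hj']
        rw [this]
        exact ht0 i
  have hA : columnPairing U V s =
      columnPairing U' V' fun i => if (i : ℕ) < min c (min m n) then t i else 0 := by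
    ext a b
    simp only [columnPairing, Matrix.of_apply]
    refine Finset.sum_congr rfl fun i _ => ?_
    by_cases hi : (i : ℕ) < c
    · rw [if_pos (lt_min hi i.isLt), (hUU' (Fin.castLE _ i) a).1 hi,
        (hVV' (Fin.castLE _ i) b).1 hi]
      simp only [t, if_pos hi]
    · rw [if_neg (fun h => hi (lt_min_iff.mp h).1), hrank i (not_lt.mp hi)]
      simp
  refine ⟨columnPairing U' V' t, ?_, ?_⟩
  · rw [hA]
    exact columnPairing_mem_truncSet hU' hV' ht ht0
  · rw [← sub_eq_iff_eq_add', hA, dotProduct_columnPairing_mulVec,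
      dotProduct_columnPairing_mulVec, ← Finset.sum_sub_distrib,
      Finset.sum_eq_single ⟨c, lt_min hltm hltn⟩]
    · have h1 : (U'ᵀ *ᵥ x) ⟨c, hltm⟩ = x ⬝ᵥ u := by
        rw [dotProduct_comm]
        exact congrArg (· ⬝ᵥ x) (funext fun a => (hUU' ⟨c, hltm⟩ a).2 rfl)
      have h2 : (V'ᵀ *ᵥ y) ⟨c, hltn⟩ = y ⬝ᵥ w := by
        rw [dotProduct_comm]
        exact congrArg (· ⬝ᵥ y) (funext fun a => (hVV' ⟨c, hltn⟩ a).2 rfl)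
      simp [t, h1, h2]
    · intro i _ hi
      have hic : (i : ℕ) ≠ c := fun h => hi (Fin.ext h)
      by_cases h : (i : ℕ) < c
      · rw [if_pos (lt_min h i.isLt), sub_self]
      · simp [t, h, hic]
    · simp

theorem exists_unit_ker_dotProduct_eq {p q l : ℕ} {M : Matrix (Fin l) (Fin p) ℝ}
    {W : Matrix (Fin p) (Fin q) ℝ} (hW : Wᵀ * W = 1)
    (hker : ∀ u, M *ᵥ u = 0 ↔ ∃ z, W *ᵥ z = u) (x : Fin p → ℝ)
    (hx : √((Wᵀ *ᵥ x) ⬝ᵥ (Wᵀ *ᵥ x)) ≠ 0) :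
    ∃ u, u ⬝ᵥ u = 1 ∧ M *ᵥ u = 0 ∧ x ⬝ᵥ u = √((Wᵀ *ᵥ x) ⬝ᵥ (Wᵀ *ᵥ x)) := by
  set α := √((Wᵀ *ᵥ x) ⬝ᵥ (Wᵀ *ᵥ x)) with hα
  have hsq : (Wᵀ *ᵥ x) ⬝ᵥ (Wᵀ *ᵥ x) = α * α :=
    (Real.mul_self_sqrt (Finset.sum_nonneg fun i _ => mul_self_nonneg _)).symm
  have hker' : M *ᵥ (W *ᵥ (Wᵀ *ᵥ x)) = 0 := (hker _).mpr ⟨_, rfl⟩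
  have hself := dotProduct_mulVec_self_of_transpose_mul_self hW (Wᵀ *ᵥ x)
  refine ⟨α⁻¹ • W *ᵥ (Wᵀ *ᵥ x), ?_, ?_, ?_⟩
  · rw [smul_dotProduct, dotProduct_smul, hself, hsq, smul_eq_mul, smul_eq_mul]
    field_simp
  · rw [Matrix.mulVec_smul, hker', smul_zero]
  · rw [dotProduct_smul, ← dotProduct_projection hW hker x hker', hself, hsq, smul_eq_mul]
    field_simp

end LimitedRank

/-- Payoff bounds in the limited-rank game: for a perceived matrix `A` at
capability `c` (so `rank A ≤ c`), with concretization set the matrices `B`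
whose best rank-`c` truncated-SVD approximation can equal `A`,
`P⁻(A,c,x,y) = xᵀAy − σ_c(A)·‖N(Aᵀ)ᵀx‖₂·‖N(A)ᵀy‖₂` and
`P⁺(A,c,x,y) = xᵀAy + σ_c(A)·‖N(Aᵀ)ᵀx‖₂·‖N(A)ᵀy‖₂`. -/
theorem limited_rank_payoff_bounds (m n c : ℕ) (hc : 1 ≤ c)
    (A : Matrix (Fin m) (Fin n) ℝ) (hrank : A.rank ≤ c)
    (s : Fin (min m n) → ℝ) (hsvd : HasSingVals m n A s)
    -- the c-th largest singular value of A
    (σc : ℝ)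
    (hσc : σc = if h : c - 1 < min m n then s ⟨c - 1, h⟩ else 0)
    -- orthonormal bases of the null spaces of A and Aᵀ
    (k k' : ℕ)
    (NA : Matrix (Fin n) (Fin k) ℝ) (NAt : Matrix (Fin m) (Fin k') ℝ)
    (hNA1 : NA.transpose * NA = 1)
    (hNA2 : ∀ y : Fin n → ℝ, A.mulVec y = 0 ↔ ∃ z, NA.mulVec z = y)
    (hNAt1 : NAt.transpose * NAt = 1)
    (hNAt2 : ∀ x : Fin m → ℝ, A.transpose.mulVec x = 0 ↔ ∃ z, NAt.mulVec z = x)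
    (x : Fin m → ℝ) (y : Fin n → ℝ)
    -- the concretization set of A at capability c
    (C : Set (Matrix (Fin m) (Fin n) ℝ))
    (hC : C = {B | A ∈ truncSet m n (min c (min m n)) B}) :
    sInf {z : ℝ | ∃ B ∈ C, z = x ⬝ᵥ B.mulVec y}
        = x ⬝ᵥ A.mulVec y - σc * Real.sqrt (∑ i, (NAt.transpose.mulVec x i) ^ 2)
            * Real.sqrt (∑ i, (NA.transpose.mulVec y i) ^ 2) ∧
      sSup {z : ℝ | ∃ B ∈ C, z = x ⬝ᵥ B.mulVec y}
        = x ⬝ᵥ A.mulVec y + σc * Real.sqrt (∑ i, (NAt.transpose.mulVec x i) ^ 2)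
            * Real.sqrt (∑ i, (NA.transpose.mulVec y i) ^ 2) := by
  obtain ⟨U, V, hU, hV, hs, hs0, hA⟩ := hsvd
  replace hA : A = columnPairing U V s := Matrix.ext hA
  have hzero (i : Fin (min m n)) (hi : c ≤ i) : s i = 0 :=
    eq_zero_of_rank_le hU hV hs hs0 (hA ▸ hrank) i hi
  have hσ0 : 0 ≤ σc := by
    rw [hσc]
    split_ifs
    exacts [hs0 _, le_rfl]
  have hα : ∑ i, (NAt.transpose.mulVec x i) ^ 2 = (NAtᵀ *ᵥ x) ⬝ᵥ (NAtᵀ *ᵥ x) := by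
    simp only [dotProduct, sq]
  have hβ : ∑ i, (NA.transpose.mulVec y i) ^ 2 = (NAᵀ *ᵥ y) ⬝ᵥ (NAᵀ *ᵥ y) := by
    simp only [dotProduct, sq]
  rw [hα, hβ]
  have hbound (B) (hB : B ∈ C) := abs_payoff_sub_le hσ0 (A := A) (B := B) (r := min c (min m n))
    (by rw [hC] at hB; exact hB) (by
    intro U' V' t hU' hV' ht ht0 hA' i hi
    have hci : c ≤ i := by have := i.isLt; omega
    have hlt : c - 1 < min m n := by have := i.isLt; omega
    rw [hσc, dif_pos hlt]
    have hle := le_of_columnPairing_eq hU hV hU' hV' (hA'.symm.trans hA) ⟨c - 1, hlt⟩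
      (fun l hl => by
        have hl' : (l : ℕ) ≤ c - 1 := hl
        have := l.isLt
        rw [if_pos (show c - 1 < _ by omega), if_pos (by omega)]
        exact ht hl) (fun l hl => hs hl) hs0
    rw [if_pos (show c - 1 < _ by omega)] at hle
    exact (ht (Fin.mk_le_mk.mpr (by omega) : ⟨c - 1, hlt⟩ ≤ i)).trans hle)
    hNA1 hNA2 hNAt1 hNAt2 x y
  have hattain (ε : ℝ) (hε : ε * ε = 1) : ∃ B ∈ C, x ⬝ᵥ B *ᵥ y = x ⬝ᵥ A *ᵥ y +
      ε * (σc * √((NAtᵀ *ᵥ x) ⬝ᵥ (NAtᵀ *ᵥ x)) * √((NAᵀ *ᵥ y) ⬝ᵥ (NAᵀ *ᵥ y))) := by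
    rw [hC]
    by_cases h0 : σc * √((NAtᵀ *ᵥ x) ⬝ᵥ (NAtᵀ *ᵥ x)) * √((NAᵀ *ᵥ y) ⬝ᵥ (NAᵀ *ᵥ y)) = 0
    · refine ⟨A, ?_, by rw [h0, mul_zero, add_zero]⟩
      have hmem := columnPairing_mem_truncSet (r := min c (min m n)) hU hV hs hs0
      have hstrunc :
          (fun i : Fin (min m n) => if (i : ℕ) < min c (min m n) then s i else 0) = s := by
        funext i
        split_ifs with hi
        · rfl
        · exact (hzero i (by have := i.isLt; omega)).symm
      rw [hstrunc, ← hA] at hmem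
      exact hmem
    · obtain ⟨⟨hσne, hαne⟩, hβne⟩ := by simpa only [mul_eq_zero, not_or] using h0
      obtain ⟨u, hu1, hu, hxu⟩ := exists_unit_ker_dotProduct_eq hNAt1 hNAt2 x hαne
      obtain ⟨w, hw1, hw, hyw⟩ := exists_unit_ker_dotProduct_eq hNA1 hNA2 y hβne
      have hlt : c - 1 < min m n := by
        by_contra h
        exact hσne (by rw [hσc, dif_neg h])
      rw [dif_pos hlt] at hσc
      obtain ⟨B, hB, hpay⟩ := exists_mem_truncSet_payoff_eq hc hU hV hs hs0 hzero hlt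
        (hσc ▸ hσ0.lt_of_ne' hσne) hu1 (w := ε • w)
        (by rw [smul_dotProduct, dotProduct_smul, hw1, smul_eq_mul, smul_eq_mul, mul_one, hε])
        (hA ▸ hu) (by rw [Matrix.mulVec_smul, ← hA, hw, smul_zero]) x y
      refine ⟨B, hA ▸ hB, ?_⟩
      rw [hpay, ← hσc, ← hA, hxu, dotProduct_smul, hyw, smul_eq_mul]
      ring
  constructor
  · refine IsLeast.csInf_eq ⟨?_, ?_⟩
    · obtain ⟨B, hB, h⟩ := hattain (-1) (by norm_num)
      exact ⟨B, hB, by rw [h]; ring⟩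
    · rintro z ⟨B, hB, rfl⟩
      linarith [(abs_le.mp (hbound B hB)).1]
  · refine IsGreatest.csSup_eq ⟨?_, ?_⟩
    · obtain ⟨B, hB, h⟩ := hattain 1 (by norm_num)
      exact ⟨B, hB, by rw [h]; ring⟩
    · rintro z ⟨B, hB, rfl⟩
      linarith [(abs_le.mp (hbound B hB)).2]
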